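/- The map k ↦ k^0 is an injective group homomorphism from ker P into the derived group G_ρ; for any x ∈ G with P(x) = 1, the elements x^n (n ∈ ℤ) freely generate a free subgroup F of G_ρ of countably infinite rank; and G_ρ is the internal free product of the image of ker P under k ↦ k^0 and F. In particular, G_ρ is isomorphic to the free product of ker P with a free group of countably infinite rank. -/

import Mathlib

/-- The defining relators of Crowell's derived group of the permutation
representation associated to a right action `act` of `G` on `Γ`:
`(γ, g*h) * ((γ, g) * (γ·g, h))⁻¹` for `g, h ∈ G` and `γ ∈ Γ`. -/
def derivedRels {Γ : Type*} {G : Type*} [Group G] (act : Γ → G → Γ) :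
    Set (FreeGroup (Γ × G)) :=
  {r | ∃ (γ : Γ) (g h : G),
    r = FreeGroup.of (γ, g * h) *
      (FreeGroup.of (γ, g) * FreeGroup.of (act γ g, h))⁻¹}

/-- Crowell's derived group `G_ρ`. -/
def DerivedGroup {Γ : Type*} {G : Type*} [Group G] (act : Γ → G → Γ) :=
  PresentedGroup (derivedRels act)

instance {Γ : Type*} {G : Type*} [Group G] (act : Γ → G → Γ) :
    Group (DerivedGroup act) :=
  inferInstanceAs (Group (PresentedGroup (derivedRels act)))

/-- The generator `g^γ` of the derived group. -/
def derivedGen {Γ : Type*} {G : Type*} [Group G] (act : Γ → G → Γ)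
    (γ : Γ) (g : G) : DerivedGroup act :=
  PresentedGroup.of (rels := derivedRels act) (γ, g)

section DerivedGroup

variable {Γ G : Type*} [Group G] {act : Γ → G → Γ}

theorem derivedGen_mul (γ : Γ) (g h : G) :
    derivedGen act γ (g * h) = derivedGen act γ g * derivedGen act (act γ g) h := by
  have h1 : PresentedGroup.mk (derivedRels act) (FreeGroup.of (γ, g * h) *
      (FreeGroup.of (γ, g) * FreeGroup.of (act γ g, h))⁻¹) = 1 :=
    PresentedGroup.one_of_mem ⟨γ, g, h, rfl⟩
  rw [map_mul, map_inv, mul_inv_eq_one, map_mul] at h1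
  exact h1

theorem derivedGen_one {γ : Γ} (hγ : act γ 1 = γ) : derivedGen act γ 1 = 1 := by
  have h := derivedGen_mul (act := act) γ 1 1
  rwa [hγ, mul_one, right_eq_mul] at h

/-- A groupoid morphism from the action groupoid of `act` to a group `H` induces a homomorphism
from the derived group to `H`. -/
def derivedLift {H : Type*} [Group H] (f : Γ → G → H)
    (hf : ∀ γ g h, f γ (g * h) = f γ g * f (act γ g) h) : DerivedGroup act →* H :=
  PresentedGroup.toGroup (rels := derivedRels act) (f := fun p : Γ × G => f p.1 p.2) (by
    rintro _ ⟨γ, g, h, rfl⟩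
    simp [hf])

theorem derivedLift_gen {H : Type*} [Group H] (f : Γ → G → H)
    (hf : ∀ γ g h, f γ (g * h) = f γ g * f (act γ g) h) (γ : Γ) (g : G) :
    derivedLift f hf (derivedGen act γ g) = f γ g :=
  PresentedGroup.toGroup.of _

theorem derivedGroup_hom_ext {H : Type*} [Group H] {f f' : DerivedGroup act →* H}
    (h : ∀ γ g, f (derivedGen act γ g) = f' (derivedGen act γ g)) : f = f' :=
  PresentedGroup.ext (rels := derivedRels act) fun p => h p.1 p.2

/-- The map `k ↦ k^γ` as a homomorphism on a subgroup of the stabilizer of `γ`. -/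
def derivedStabHom (act : Γ → G → Γ) (γ : Γ) (K : Subgroup G) (hK : ∀ k ∈ K, act γ k = γ) :
    K →* DerivedGroup act :=
  MonoidHom.mk' (fun k => derivedGen act γ (k : G)) fun a b => by
    simp [derivedGen_mul, hK a a.2]

end DerivedGroup

/-- A sequence indexed by `ℤ` in a group can be prescribed by its value at `0` and its successive
quotients. -/
theorem exists_int_partial_prod {H : Type*} [Group H] (a : ℤ → H) :
    ∃ p : ℤ → H, p 0 = 1 ∧ ∀ n, p (n + 1) = p n * a n := by
  let e : Equiv.Perm (ℤ × H) :=
    { toFun := fun q => (q.1 + 1, q.2 * a q.1)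
      invFun := fun q => (q.1 - 1, q.2 * (a (q.1 - 1))⁻¹)
      left_inv := fun q => by simp
      right_inv := fun q => by simp }
  have step (n : ℤ) : (e ^ (n + 1)) (0, 1) = e ((e ^ n) (0, 1)) := by
    rw [add_comm, zpow_add, zpow_one, Equiv.Perm.mul_apply]
  have fst (n : ℤ) : ((e ^ n) (0, 1)).1 = n := by
    have succ (m : ℤ) : ((e ^ (m + 1)) (0, 1)).1 = ((e ^ m) (0, 1)).1 + 1 := by
      rw [step]; rfl
    induction n with
    | zero => simp
    | succ n ih => rw [succ, ih]
    | pred n ih =>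
      have := succ (-(n : ℤ) - 1)
      rw [sub_add_cancel, ih] at this
      omega
  refine ⟨fun n => ((e ^ n) (0, 1)).2, by simp, fun n => ?_⟩
  have : ((e ^ (n + 1)) (0, 1)).2 = ((e ^ n) (0, 1)).2 * a ((e ^ n) (0, 1)).1 := by
    rw [step]; rfl
  rwa [fst] at this

theorem bijective_coprod_lift_derived {G : Type*} [Group G] (P : G →* Multiplicative ℤ)
    {act : ℤ → G → ℤ} (hact : ∀ (n : ℤ) (g : G), act n g = n + Multiplicative.toAdd (P g))
    (j : P.ker →* DerivedGroup act) (hj : ∀ k : P.ker, j k = derivedGen act 0 (k : G))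
    {x : G} (hx : P x = Multiplicative.ofAdd 1) :
    Function.Bijective
      (Monoid.Coprod.lift j (FreeGroup.lift fun n : ℤ => derivedGen act n x)) := by
  set ψ := Monoid.Coprod.lift j (FreeGroup.lift fun n : ℤ => derivedGen act n x) with hψ
  obtain ⟨p, p_zero, p_succ⟩ := exists_int_partial_prod
    fun n : ℤ => (Monoid.Coprod.inr (FreeGroup.of n) : Monoid.Coprod P.ker (FreeGroup ℤ))
  have hPx (n : ℤ) : P (x ^ n) = Multiplicative.ofAdd n := by
    rw [map_zpow, hx, ← ofAdd_zsmul]; simp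
  have hker (n : ℤ) (g : G) : x ^ n * g * (x ^ act n g)⁻¹ ∈ P.ker := by
    rw [MonoidHom.mem_ker, map_mul, map_mul, map_inv, hPx, hPx, hact]
    simp
  let c (n : ℤ) (g : G) : P.ker := ⟨x ^ n * g * (x ^ act n g)⁻¹, hker n g⟩
  have hc (n : ℤ) (g h : G) : c n (g * h) = c n g * c (act n g) h := by
    have : act n (g * h) = act (act n g) h := by simp [hact, add_assoc]
    apply Subtype.ext
    simp only [c, Subgroup.coe_mul, this]
    group
  let φ : DerivedGroup act →* Monoid.Coprod P.ker (FreeGroup ℤ) :=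
    derivedLift (fun n g => (p n)⁻¹ * Monoid.Coprod.inl (c n g) * p (act n g)) fun n g h => by
      have : act n (g * h) = act (act n g) h := by simp [hact, add_assoc]
      rw [hc, map_mul, this]
      group
  have hφ (n : ℤ) (g : G) : φ (derivedGen act n g) =
      (p n)⁻¹ * Monoid.Coprod.inl (c n g) * p (act n g) := derivedLift_gen _ _ n g
  have hφψ : φ.comp ψ = MonoidHom.id _ := by
    apply Monoid.Coprod.hom_ext
    · ext1 k
      have hk : act 0 k = 0 := by rw [hact, MonoidHom.mem_ker.1 k.2]; simp
      have : c 0 k = k := Subtype.ext (by simp [c, hk])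
      simp [hψ, hj, hφ, hk, p_zero, this]
    · ext n
      have hn : act n x = n + 1 := by rw [hact, hx]; simp
      have : c n x = 1 := Subtype.ext (by simp [c, hn, zpow_add_one])
      simp [hψ, hφ, hn, p_succ, this]
  have h0 (n : ℤ) : act 0 (x ^ n) = n := by rw [hact, hPx]; simp
  have hψp (n : ℤ) : ψ (p n) = derivedGen act 0 (x ^ n) := by
    have succ (m : ℤ) : ψ (p (m + 1)) = ψ (p m) * derivedGen act m x := by
      simp [hψ, p_succ]
    have succ' (m : ℤ) :
        derivedGen act 0 (x ^ (m + 1)) = derivedGen act 0 (x ^ m) * derivedGen act m x := by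
      rw [zpow_add_one, derivedGen_mul, h0]
    induction n with
    | zero => rw [p_zero, map_one, zpow_zero, derivedGen_one (by simp [hact])]
    | succ n ih => rw [succ, succ', ih]
    | pred n ih =>
      rw [← sub_add_cancel (-(n : ℤ)) 1, succ, succ'] at ih
      exact mul_right_cancel ih
  have hψφ : ψ.comp φ = MonoidHom.id _ := by
    apply derivedGroup_hom_ext
    intro n g
    have hinl : ψ (Monoid.Coprod.inl (c n g)) = derivedGen act 0 (c n g : G) := by
      simp [hψ, hj]
    have hc0 : act 0 (c n g : G) = 0 := by rw [hact, MonoidHom.mem_ker.1 (c n g).2]; simp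
    have key : derivedGen act 0 (c n g : G) * derivedGen act 0 (x ^ act n g) =
        derivedGen act 0 (x ^ n) * derivedGen act n g := by
      have h1 := derivedGen_mul (act := act) 0 (c n g : G) (x ^ act n g)
      have h2 := derivedGen_mul (act := act) 0 (x ^ n) g
      rw [hc0] at h1
      rw [h0] at h2
      rw [← h1, ← h2]
      simp [c]
    rw [MonoidHom.comp_apply, hφ, map_mul, map_mul, map_inv, hψp, hψp, hinl, mul_assoc, key]
    simp
  exact ⟨Function.LeftInverse.injective (DFunLike.congr_fun hφψ),
    Function.RightInverse.surjective (DFunLike.congr_fun hψφ)⟩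

/-- For a surjective homomorphism `P : G → ℤ` with `Γ = ℤ` and action
`n·g = n + P(g)`: the map `k ↦ k^0` embeds `ker P` in the derived group, the
generators `x^n` (for `P(x) = 1`) freely generate a free subgroup of countably
infinite rank, and the derived group is the internal free product of the two;
in particular it is isomorphic to `ker P ∗ F(ℤ)`. -/
theorem derived_of_surjection_to_int {G : Type*} [Group G]
    (P : G →* Multiplicative ℤ) (hP : Function.Surjective P)
    (act : ℤ → G → ℤ)
    (hact : ∀ (n : ℤ) (g : G), act n g = n + Multiplicative.toAdd (P g)) :
    ∃ j : P.ker →* DerivedGroup act,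
      (∀ k : P.ker, j k = derivedGen act 0 (k : G)) ∧
      Function.Injective j ∧
      (∀ x : G, P x = Multiplicative.ofAdd 1 →
        Function.Injective (FreeGroup.lift fun n : ℤ => derivedGen act n x) ∧
        Function.Bijective
          (Monoid.Coprod.lift j (FreeGroup.lift fun n : ℤ => derivedGen act n x))) ∧
      Nonempty (DerivedGroup act ≃* Monoid.Coprod P.ker (FreeGroup ℤ)) := by
  let j := derivedStabHom act 0 P.ker fun k hk => by
    rw [hact, MonoidHom.mem_ker.1 hk]; simp
  have hj (k : P.ker) : j k = derivedGen act 0 (k : G) := rfl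
  have bij (x : G) (hx : P x = Multiplicative.ofAdd 1) :=
    bijective_coprod_lift_derived P hact j hj hx
  obtain ⟨x, hx⟩ := hP (Multiplicative.ofAdd 1)
  refine ⟨j, hj, ?_, fun y hy => ⟨?_, bij y hy⟩, ⟨(MulEquiv.ofBijective _ (bij x hx)).symm⟩⟩
  · have h := (bij x hx).1.comp Monoid.Coprod.inl_injective
    rwa [← MonoidHom.coe_comp, Monoid.Coprod.lift_comp_inl] at h
  · have h := (bij y hy).1.comp Monoid.Coprod.inr_injective
    rwa [← MonoidHom.coe_comp, Monoid.Coprod.lift_comp_inr] at h
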